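/- arXiv:2406.13582 — 2 statements merged into one kernel-verified Lean document; each statement's English description precedes it below -/
import Mathlib

section
/- Let R be an indecomposable semiperfect ring that is left noetherian and right noetherian. Then for any two simple right R-modules S and T, either both S and T are finite sets, or S and T have the same (infinite) cardinality. -/
universe u

/-- A ring is semiperfect if `R/J(R)` is a semisimple ring and idempotents lift
modulo the Jacobson radical `J(R)`. -/
def IsSemiperfectRing (R : Type u) [Ring R] : Prop :=
  IsSemisimpleRing ((⊥ : TwoSidedIdeal R).jacobson.ringCon.Quotient) ∧
  ∀ a : R, a * a - a ∈ (⊥ : TwoSidedIdeal R).jacobson →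
    ∃ e : R, IsIdempotentElem e ∧ e - a ∈ (⊥ : TwoSidedIdeal R).jacobson

/-- A nonzero ring is indecomposable if its only central idempotents are `0` and `1`. -/
def IsIndecomposableRing (R : Type u) [Ring R] : Prop :=
  Nontrivial R ∧ ∀ e : R, IsIdempotentElem e → e ∈ Set.center R → e = 0 ∨ e = 1

open Cardinal

section SumOfSimples

variable {A : Type u} [Ring A] {M X : Type u} [AddCommGroup M] [Module A M]
  [AddCommGroup X] [Module A X]

/-- The sum of the simple submodules whose cardinality satisfies `p`. -/
def sumOfSimples (A : Type u) [Ring A] (M : Type u) [AddCommGroup M] [Module A M]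
    (p : Cardinal.{u} → Prop) : Submodule A M :=
  sSup {S | IsSimpleModule A S ∧ p #S}

theorem sumOfSimples_le_comap (p : Cardinal.{u} → Prop) (f : M →ₗ[A] M) :
    sumOfSimples A M p ≤ (sumOfSimples A M p).comap f := by
  refine sSup_le fun S ⟨hS, hp⟩ ↦ Submodule.map_le_iff_le_comap.mp ?_
  refine (S.map_le_isotypicComponent f).trans (sSup_le_sSup ?_)
  rintro T ⟨e⟩
  refine ⟨IsSimpleModule.congr e, ?_⟩
  rwa [Cardinal.mk_congr e.toEquiv]

theorem sumOfSimples_le_ker [IsSimpleModule A X] {p : Cardinal.{u} → Prop} (hX : ¬ p #X)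
    (f : M →ₗ[A] X) : sumOfSimples A M p ≤ LinearMap.ker f := by
  refine sSup_le fun S ⟨hS, hp⟩ x hx ↦ ?_
  by_contra hne
  have h0 : f ∘ₗ S.subtype ≠ 0 := fun h ↦ hne (by simpa using LinearMap.congr_fun h ⟨x, hx⟩)
  have hb := LinearMap.bijective_of_ne_zero h0
  exact hX (by rwa [← Cardinal.mk_congr (Equiv.ofBijective _ hb)])

theorem sumOfSimples_sup_sumOfSimples_not [IsSemisimpleModule A M] (p : Cardinal.{u} → Prop) :
    sumOfSimples A M p ⊔ sumOfSimples A M (fun c ↦ ¬ p c) = ⊤ := by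
  rw [eq_top_iff, ← IsSemisimpleModule.sSup_simples_eq_top]
  refine sSup_le fun S hS ↦ ?_
  by_cases h : p #S
  · exact le_sup_of_le_left (le_sSup ⟨hS, h⟩)
  · exact le_sup_of_le_right (le_sSup ⟨hS, h⟩)

theorem prop_of_simple_le_sumOfSimples {p : Cardinal.{u} → Prop} {S : Submodule A M}
    [IsSimpleModule A S] (h : S ≤ sumOfSimples A M p) : p #S := by
  have (m : {S : Submodule A M | IsSimpleModule A S ∧ p #S}) : IsSimpleModule A m := m.2.1
  obtain ⟨T, hT, ⟨e⟩⟩ := S.linearEquiv_of_le_sSup _ h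
  rw [Cardinal.mk_congr e.toEquiv]
  exact hT.2

theorem sumOfSimples_inf_sumOfSimples_not [IsSemisimpleModule A M] (p : Cardinal.{u} → Prop) :
    sumOfSimples A M p ⊓ sumOfSimples A M (fun c ↦ ¬ p c) = ⊥ := by
  refine (IsSemisimpleModule.eq_bot_or_exists_simple_le _).resolve_right ?_
  rintro ⟨S, hS, _⟩
  exact prop_of_simple_le_sumOfSimples (hS.trans inf_le_right)
    (prop_of_simple_le_sumOfSimples (hS.trans inf_le_left))

theorem Cardinal.mk_pi_lt_of_finite {ι : Type} [Fintype ι] {κ : Cardinal.{u}} (hκ : ℵ₀ ≤ κ)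
    (B : ι → Type u) (hB : ∀ i, #(B i) < κ) : #(∀ i, B i) < κ := by
  rw [Cardinal.mk_pi, Cardinal.prod_eq_of_fintype, Cardinal.lift_uzero]
  exact Finset.prod_induction _ (· < κ) (fun _ _ ↦ Cardinal.mul_lt_of_lt hκ)
    (Cardinal.one_lt_aleph0.trans_le hκ) fun i _ ↦ hB i

theorem mk_sumOfSimples_lt [IsSemisimpleModule A M] [IsNoetherian A M] {κ : Cardinal.{u}}
    (hκ : ℵ₀ ≤ κ) : #(sumOfSimples A M (· < κ)) < κ := by
  classical
  obtain ⟨n, S, e, hS⟩ := IsSemisimpleModule.exists_linearEquiv_fin_dfinsupp A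
    (sumOfSimples A M (· < κ))
  rw [Cardinal.mk_congr (e.toEquiv.trans DFinsupp.equivFunOnFintype)]
  refine Cardinal.mk_pi_lt_of_finite hκ _ fun i ↦ ?_
  have e' := (S i).equivMapOfInjective _ (Submodule.subtype_injective (sumOfSimples A M (· < κ)))
  have := IsSimpleModule.congr e'.symm
  rw [Cardinal.mk_congr e'.toEquiv]
  exact prop_of_simple_le_sumOfSimples (p := (· < κ)) (Submodule.map_subtype_le _ _)

end SumOfSimples

/-- The cardinality of the simple modules is detected by a central idempotent modulo `J`. -/
theorem exists_central_idempotent_quotient {A : Type u} [Ring A] [IsNoetherianRing A] (J : Ideal A)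
    [J.IsTwoSided] [IsSemisimpleModule A (A ⧸ J)] (hJ : J ≤ Ring.jacobson A) {κ : Cardinal.{u}}
    (hκ : ℵ₀ ≤ κ) :
    ∃ U : Submodule A (A ⧸ J), #U < κ ∧ ∃ u ∈ U, u * u = u ∧ (∀ q, u * q = q * u) ∧
      ∀ a : A, Ideal.Quotient.mk J a = u →
        ∀ (X : Type u) [AddCommGroup X] [Module A X] [IsSimpleModule A X],
          (#X < κ → ∀ x : X, (1 - a) • x = 0) ∧ (κ ≤ #X → ∀ x : X, a • x = 0) := by
  set U := sumOfSimples A (A ⧸ J) (· < κ)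
  set W := sumOfSimples A (A ⧸ J) (fun c ↦ ¬ c < κ)
  have hinf : ∀ x, x ∈ U → x ∈ W → x = 0 := fun x hU hW ↦ by
    have : x ∈ U ⊓ W := ⟨hU, hW⟩
    rwa [sumOfSimples_inf_sumOfSimples_not, Submodule.mem_bot] at this
  have hleft (N : Submodule A (A ⧸ J)) (q x) (hx : x ∈ N) : q * x ∈ N := by
    obtain ⟨a, rfl⟩ := Ideal.Quotient.mk_surjective q
    exact N.smul_mem a hx
  have hright (p) (q x) (hx : x ∈ sumOfSimples A (A ⧸ J) p) : x * q ∈ sumOfSimples A (A ⧸ J) p := by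
    let f : (A ⧸ J) →ₗ[A] (A ⧸ J) :=
      { toFun := (· * q), map_add' := fun _ _ ↦ add_mul _ _ _
        map_smul' := fun a x ↦ smul_mul_assoc a x q }
    exact sumOfSimples_le_comap p f hx
  have h1 : (1 : A ⧸ J) ∈ U ⊔ W := by
    rw [sumOfSimples_sup_sumOfSimples_not]; trivial
  obtain ⟨u, hu, w, hw, huw⟩ := Submodule.mem_sup.mp h1
  refine ⟨U, mk_sumOfSimples_lt hκ, u, hu, ?_, fun q ↦ ?_,
    fun a ha X _ _ _ ↦ ⟨fun hX x ↦ ?_, fun hX x ↦ ?_⟩⟩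
  · have := hinf (u * w) (hright _ _ _ hu) (hleft W _ _ hw)
    calc u * u = u * (u + w) - u * w := by noncomm_ring
      _ = u := by rw [huw, this, mul_one, sub_zero]
  · rw [← sub_eq_zero]
    refine hinf _ (U.sub_mem (hright _ _ _ hu) (hleft U _ _ hu)) ?_
    have : u * q - q * u = q * w - w * q := by
      have : (u + w) * q = q * (u + w) := by rw [huw, one_mul, mul_one]
      rw [add_mul, mul_add] at this
      rw [sub_eq_sub_iff_add_eq_add, this, add_comm]
    rw [this]
    exact W.sub_mem (hleft W _ _ hw) (hright _ _ _ hw)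
  all_goals
    let f : (A ⧸ J) →ₗ[A] X := J.liftQ (LinearMap.toSpanSingleton A X x) fun a ha ↦ by
      simpa using Module.mem_annihilator.mp
        (IsSemisimpleModule.jacobson_le_annihilator A X (hJ ha)) x
    have hf (b : A) : f (Ideal.Quotient.mk J b) = b • x := rfl
    rw [← hf]
  · refine sumOfSimples_le_ker (p := fun c ↦ ¬ c < κ) (not_not.mpr hX) f ?_
    rwa [map_sub, map_one, ha, ← huw, add_sub_cancel_left]
  · exact sumOfSimples_le_ker (p := (· < κ)) hX.not_gt f (ha ▸ hu)

/-- Cardinality bound for a bimodule subquotient `I / N` finitely generated on one side, in terms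
of a biadditive operation so that it applies to both left and right multiplication. -/
theorem mk_quotient_lt_of_finite_generation {A : Type u} [AddCommGroup A] (μ : A →+ A →+ A)
    (I N P P' : AddSubgroup A) {m : ℕ} (y : Fin m → A)
    (hspan : ∀ x ∈ I, ∃ c : Fin m → A, x = ∑ k, μ (c k) (y k))
    (hmul : ∀ r j, μ (y j) r ∈ I) (hP : ∀ r ∈ P, ∀ k, μ r (y k) ∈ N)
    (hP' : ∀ r, (∀ j, μ (y j) r ∈ N) → r ∈ P') {κ : Cardinal.{u}} (hκ : ℵ₀ ≤ κ)
    (hlt : #(A ⧸ P) < κ) : #(A ⧸ P') < κ := by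
  choose c hc using fun r j ↦ hspan _ (hmul r j)
  have key (r r' : A) (h : ∀ j k, (c r j k : A ⧸ P) = c r' j k) : (r : A ⧸ P') = r' := by
    rw [QuotientAddGroup.eq]
    refine hP' _ fun j ↦ ?_
    rw [map_add, map_neg, hc r j, hc r' j, ← Finset.sum_neg_distrib, ← Finset.sum_add_distrib]
    refine sum_mem fun k _ ↦ ?_
    have := hP _ (QuotientAddGroup.eq.mp (h j k)) k
    rwa [map_add, map_neg] at this
  refine lt_of_le_of_lt (Cardinal.mk_le_of_injective
    (f := fun (q : A ⧸ P') (jk : Fin m × Fin m) ↦ (c q.out jk.1 jk.2 : A ⧸ P)) ?_)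
    (Cardinal.mk_pi_lt_of_finite hκ _ fun _ ↦ hlt)
  intro q q' h
  have := key q.out q'.out fun j k ↦ congr_fun h (j, k)
  rwa [QuotientAddGroup.out_eq', QuotientAddGroup.out_eq'] at this

/-- Nakayama's lemma relative to a submodule. -/
theorem Submodule.FG.le_of_le_sup_jacobson_smul {A M : Type*} [Ring A] [AddCommGroup M] [Module A M]
    {I N : Submodule A M} (hI : I.FG) (h : I ≤ N ⊔ Ring.jacobson A • I) : I ≤ N := by
  have h1 : I.map N.mkQ = ⊥ := by
    refine (hI.map N.mkQ).eq_bot_of_le_jacobson_smul ?_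
    rw [← Submodule.map_smul'']
    refine (Submodule.map_mono h).trans ?_
    rw [Submodule.map_sup, Submodule.mkQ_map_self, bot_sup_eq]
  rw [eq_bot_iff, Submodule.map_le_iff_le_comap] at h1
  simpa [Submodule.ker_mkQ] using! h1

theorem Ideal.le_jacobson_of_isUnit_one_add {A : Type*} [Ring A] {J : Ideal A}
    (hJ : ∀ x ∈ J, IsUnit (1 + x)) : J ≤ Ring.jacobson A := by
  rw [Ring.jacobson_eq_sInf_isMaximal]
  refine le_sInf fun m hm x hx ↦ ?_
  by_contra hxm
  have htop : m ⊔ Ideal.span {x} = ⊤ := hm.1.2 _ (by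
    rw [left_lt_sup, Ideal.span_singleton_le_iff_mem]; exact hxm)
  obtain ⟨y, hy, z, hz, hyz⟩ := Submodule.mem_sup.mp (htop ▸ Submodule.mem_top : (1 : A) ∈ _)
  have hz' : z ∈ J := (Ideal.span_singleton_le_iff_mem J).mpr hx hz
  refine hm.ne_top (Ideal.eq_top_of_isUnit_mem m hy ?_)
  have := hJ _ (J.neg_mem hz')
  rwa [← hyz, add_neg_cancel_right] at this

open MulOpposite in
/-- An additive subgroup closed under right multiplication, as an ideal of the opposite ring. -/
def AddSubgroup.opIdeal {A : Type*} [Ring A] (I : AddSubgroup A)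
  (h : ∀ x ∈ I, ∀ r, x * r ∈ I) : Ideal Aᵐᵒᵖ where
  carrier := {x | unop x ∈ I}
  add_mem' := I.add_mem
  zero_mem' := I.zero_mem
  smul_mem' r _ hx := h _ hx (unop r)

theorem Ideal.exists_fin_generators {A : Type*} [Ring A] {I : Ideal A} (hI : I.FG) :
    ∃ (m : ℕ) (y : Fin m → A), (∀ k, y k ∈ I) ∧
      ∀ x ∈ I, ∃ c : Fin m → A, x = ∑ k, c k * y k := by
  obtain ⟨m, y, hy⟩ := Submodule.fg_iff_exists_fin_generating_family.mp hI
  refine ⟨m, y, fun k ↦ hy ▸ Submodule.subset_span ⟨k, rfl⟩, fun x hx ↦ ?_⟩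
  rw [← hy, Submodule.mem_span_range_iff_exists_fun] at hx
  obtain ⟨c, hc⟩ := hx
  exact ⟨c, hc.symm⟩

theorem Ideal.exists_fin_right_generators {A : Type*} [Ring A] [IsNoetherianRing Aᵐᵒᵖ]
    (I : Ideal A) [I.IsTwoSided] :
    ∃ (m : ℕ) (y : Fin m → A), (∀ k, y k ∈ I) ∧
      ∀ x ∈ I, ∃ c : Fin m → A, x = ∑ k, y k * c k := by
  obtain ⟨m, y, hy, h⟩ := Ideal.exists_fin_generators (IsNoetherian.noetherian
    (I.toAddSubgroup.opIdeal fun x hx r ↦ I.mul_mem_right r hx))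
  refine ⟨m, fun k ↦ (y k).unop, hy, fun x hx ↦ ?_⟩
  obtain ⟨c, hc⟩ := h (.op x) hx
  refine ⟨fun k ↦ (c k).unop, ?_⟩
  simpa using congr_arg MulOpposite.unop hc

/-- A nonzero two-sided ideal `I` in a two-sided noetherian ring is strictly larger than
`J * I + I * J` for `J` inside the Jacobson radical. -/
theorem Ideal.eq_bot_of_le_mul_sup_mul {A : Type*} [Ring A] [IsNoetherianRing A]
    [IsNoetherianRing Aᵐᵒᵖ] {J I : Ideal A} [J.IsTwoSided] [I.IsTwoSided]
    (hJ : ∀ x ∈ J, IsUnit (1 + x)) (h : I ≤ J * I ⊔ I * J) : I = ⊥ := by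
  have hJop : J.toAddSubgroup.opIdeal (fun x hx r ↦ J.mul_mem_right r hx) ≤ Ring.jacobson Aᵐᵒᵖ :=
    Ideal.le_jacobson_of_isUnit_one_add fun x hx ↦ by
      simpa using (hJ x.unop hx).op
  set I' := I.toAddSubgroup.opIdeal fun x hx r ↦ I.mul_mem_right r hx
  set N' := (J * I).toAddSubgroup.opIdeal fun x hx r ↦ (J * I).mul_mem_right r hx
  have h1 : I' ≤ N' := by
    refine (IsNoetherian.noetherian I').le_of_le_sup_jacobson_smul fun x hx ↦ ?_
    obtain ⟨y, hy, z, hz, hyz⟩ := Submodule.mem_sup.mp (h hx)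
    refine Submodule.mem_sup.mpr ⟨.op y, hy, .op z, ?_, by rw [← MulOpposite.op_add, hyz]; rfl⟩
    clear hyz
    refine Submodule.mul_induction_on hz (fun i hi j hj ↦ ?_) fun z₁ z₂ h₁ h₂ ↦ ?_
    · exact Submodule.smul_mem_smul (hJop (x := .op j) hj) (show MulOpposite.op i ∈ I' from hi)
    · exact add_mem h₁ h₂
  have h2 : I ≤ J * I := fun x hx ↦ h1 (x := .op x) hx
  refine (IsNoetherian.noetherian I).eq_bot_of_le_jacobson_smul (h2.trans ?_)
  exact Submodule.smul_mono_left (Ideal.le_jacobson_of_isUnit_one_add hJ)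

/-- A nonzero off-diagonal Peirce component links two proper ideals with quotients of
the same size. -/
theorem exists_linked_ideals {A : Type u} [Ring A] [IsNoetherianRing A] [IsNoetherianRing Aᵐᵒᵖ]
    {J : Ideal A} [J.IsTwoSided] (hJ : ∀ x ∈ J, IsUnit (1 + x)) {a b s : A}
    (hba : b * a = 0) (hac : ∀ r, a * r - r * a ∈ J)
    (hbc : ∀ r, b * r - r * b ∈ J) (hs : a * s * b ≠ 0) :
    ∃ P P' : Ideal A, P.IsTwoSided ∧ P'.IsTwoSided ∧ J ≤ P ∧ J ≤ P' ∧ P ≠ ⊤ ∧ P' ≠ ⊤ ∧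
      b ∈ P ∧ a ∈ P' ∧ ∀ κ : Cardinal.{u}, ℵ₀ ≤ κ → (#(A ⧸ P) < κ ↔ #(A ⧸ P') < κ) := by
  let I : Ideal A := Ideal.span {x | ∃ s t, x = a * s * b * t}
  have hI : I.IsTwoSided := ⟨fun {x} r hx ↦ by
    induction hx using Submodule.span_induction with
    | mem x hx =>
      obtain ⟨s, t, rfl⟩ := hx
      exact Ideal.subset_span ⟨s, t * r, mul_assoc _ _ _⟩
    | zero => rw [zero_mul]; exact I.zero_mem
    | add x y _ _ hx hy => rw [add_mul]; exact I.add_mem hx hy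
    | smul c x _ hx => rw [smul_mul_assoc]; exact I.smul_mem c hx⟩
  let N : Ideal A := J * I ⊔ I * J
  have hN : N.IsTwoSided := ⟨fun {x} r hx ↦ by
    obtain ⟨y, hy, z, hz, rfl⟩ := Submodule.mem_sup.mp hx
    rw [add_mul]
    exact N.add_mem (Ideal.mem_sup_left (Ideal.mul_mem_right r _ hy))
      (Ideal.mem_sup_right (Ideal.mul_mem_right r _ hz))⟩
  have hJI {j x : A} (hj : j ∈ J) (hx : x ∈ I) : j * x ∈ N :=
    Ideal.mem_sup_left (Ideal.mul_mem_mul hj hx)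
  have hIJ {j x : A} (hj : j ∈ J) (hx : x ∈ I) : x * j ∈ N :=
    Ideal.mem_sup_right (Ideal.mul_mem_mul hx hj)
  have hIN : ¬ I ≤ N := fun h ↦ hs <| by
    have h0 := Ideal.eq_bot_of_le_mul_sup_mul hJ h
    have : a * s * b ∈ I := Ideal.subset_span ⟨s, 1, (mul_one _).symm⟩
    rwa [h0, Submodule.mem_bot] at this
  have hb : ∀ x ∈ I, b * x ∈ N := fun x hx ↦ by
    induction hx using Submodule.span_induction with
    | mem x hx =>
      obtain ⟨s, t, rfl⟩ := hx
      simp [← mul_assoc, hba]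
    | zero => rw [mul_zero]; exact N.zero_mem
    | add x y _ _ hx hy => rw [mul_add]; exact N.add_mem hx hy
    | smul c x hxI hx =>
      rw [smul_eq_mul, show b * (c * x) = (b * c - c * b) * x + c * (b * x) by noncomm_ring]
      exact N.add_mem (hJI (hbc c) hxI) (N.mul_mem_left c hx)
  have ha : ∀ x ∈ I, x * a ∈ N := fun x hx ↦ by
    induction hx using Submodule.span_induction with
    | mem x hx =>
      obtain ⟨s, t, rfl⟩ := hx
      have hI' : a * s * b ∈ I := Ideal.subset_span ⟨s, 1, (mul_one _).symm⟩
      have h0 : a * s * b * a = 0 := by rw [mul_assoc, hba, mul_zero]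
      rw [show a * s * b * t * a = a * s * b * -(a * t - t * a) + a * s * b * a * t by noncomm_ring,
        h0, zero_mul, add_zero]
      exact hIJ (J.neg_mem (hac t)) hI'
    | zero => rw [zero_mul]; exact N.zero_mem
    | add x y _ _ hx hy => rw [add_mul]; exact N.add_mem hx hy
    | smul c x _ hx => rw [smul_mul_assoc]; exact N.smul_mem c hx
  let P : Ideal A :=
    { carrier := {r | ∀ x ∈ I, r * x ∈ N}
      add_mem' := fun h h' x hx ↦ by rw [add_mul]; exact N.add_mem (h x hx) (h' x hx)
      zero_mem' := fun x _ ↦ by rw [zero_mul]; exact N.zero_mem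
      smul_mem' := fun c r h x hx ↦ by
        rw [smul_eq_mul, mul_assoc]; exact N.mul_mem_left c (h x hx) }
  let P' : Ideal A :=
    { carrier := {r | ∀ x ∈ I, x * r ∈ N}
      add_mem' := fun h h' x hx ↦ by rw [mul_add]; exact N.add_mem (h x hx) (h' x hx)
      zero_mem' := fun x _ ↦ by rw [mul_zero]; exact N.zero_mem
      smul_mem' := fun c r h x hx ↦ by
        rw [smul_eq_mul, ← mul_assoc]; exact h _ (I.mul_mem_right c hx) }
  refine ⟨P, P', ⟨fun {r} c h x hx ↦ ?_⟩, ⟨fun {r} c h x hx ↦ ?_⟩, fun j hj x hx ↦ hJI hj hx,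
    fun j hj x hx ↦ hIJ hj hx, fun h ↦ hIN fun x hx ↦ ?_, fun h ↦ hIN fun x hx ↦ ?_, hb, ha,
    fun κ hκ ↦ ⟨fun h ↦ ?_, fun h ↦ ?_⟩⟩
  · rw [mul_assoc]; exact h _ (I.mul_mem_left c hx)
  · rw [← mul_assoc]; exact N.mul_mem_right c (h x hx)
  · simpa using (h ▸ Submodule.mem_top : (1 : A) ∈ P) x hx
  · simpa using (h ▸ Submodule.mem_top : (1 : A) ∈ P') x hx
  · obtain ⟨m, y, hy, hspan⟩ := Ideal.exists_fin_generators (IsNoetherian.noetherian I)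
    refine mk_quotient_lt_of_finite_generation AddMonoidHom.mul I.toAddSubgroup N.toAddSubgroup
      P.toAddSubgroup P'.toAddSubgroup y hspan (fun r j ↦ I.mul_mem_right r (hy j))
      (fun r hr k ↦ hr _ (hy k)) (fun r hr x hx ↦ ?_) hκ h
    obtain ⟨c, rfl⟩ := hspan x hx
    rw [Finset.sum_mul]
    refine sum_mem fun k _ ↦ ?_
    rw [mul_assoc]
    exact N.mul_mem_left _ (hr k)
  · obtain ⟨m, y, hy, hspan⟩ := I.exists_fin_right_generators
    refine mk_quotient_lt_of_finite_generation AddMonoidHom.mul.flip I.toAddSubgroup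
      N.toAddSubgroup P'.toAddSubgroup P.toAddSubgroup y hspan
      (fun r j ↦ I.mul_mem_left r (hy j)) (fun r hr k ↦ hr _ (hy k)) (fun r hr x hx ↦ ?_) hκ h
    obtain ⟨c, rfl⟩ := hspan x hx
    rw [Finset.mul_sum]
    refine sum_mem fun k _ ↦ ?_
    rw [← mul_assoc]
    exact N.mul_mem_right _ (hr k)

/-- In an indecomposable ring satisfying the semiperfect and noetherian conditions, all simple
left modules are on the same side of any infinite cardinal. -/
theorem mk_simple_lt_of_mk_simple_lt {A : Type u} [Ring A] [IsNoetherianRing A]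
    [IsNoetherianRing Aᵐᵒᵖ] {J : Ideal A} [J.IsTwoSided] (hJ : ∀ x ∈ J, IsUnit (1 + x))
    [IsSemisimpleRing (A ⧸ J)]
    (hlift : ∀ a : A, a * a - a ∈ J → ∃ e : A, IsIdempotentElem e ∧ e - a ∈ J)
    (hind : ∀ e : A, IsIdempotentElem e → e ∈ Set.center A → e = 0 ∨ e = 1)
    {κ : Cardinal.{u}} (hκ : ℵ₀ ≤ κ) (S T : Type u) [AddCommGroup S] [Module A S]
    [IsSimpleModule A S] [AddCommGroup T] [Module A T] [IsSimpleModule A T] (hS : #S < κ) :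
    #T < κ := by
  have : IsSemisimpleModule A (A ⧸ J) := by
    have : RingHomSurjective (Ideal.Quotient.mk J) := ⟨Ideal.Quotient.mk_surjective⟩
    let l : (A ⧸ J) →ₛₗ[Ideal.Quotient.mk J] (A ⧸ J) :=
      { AddMonoidHom.id (A ⧸ J) with map_smul' := fun _ _ ↦ rfl }
    exact (l.isSemisimpleModule_iff_of_bijective Function.bijective_id).mpr inferInstance
  obtain ⟨U, hU, u, huU, huu, hucomm, hsimple⟩ :=
    exists_central_idempotent_quotient J (Ideal.le_jacobson_of_isUnit_one_add hJ) hκ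
  obtain ⟨a, rfl⟩ := Ideal.Quotient.mk_surjective u
  obtain ⟨e, he, hea⟩ := hlift a (by
    rw [← Ideal.Quotient.eq, map_mul]; exact huu)
  rw [← Ideal.Quotient.eq] at hea
  rw [← hea] at huU huu hucomm hsimple
  have hsimple := hsimple e rfl
  have hec (r : A) : e * r - r * e ∈ J := by
    rw [← Ideal.Quotient.eq, map_mul, map_mul]; exact hucomm _
  have hfc (r : A) : (1 - e) * r - r * (1 - e) ∈ J := by
    rw [show (1 - e) * r - r * (1 - e) = -(e * r - r * e) by noncomm_ring]
    exact J.neg_mem (hec r)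
  have hef : e * (1 - e) = 0 := by rw [mul_sub, mul_one, he.eq, sub_self]
  have hfe : (1 - e) * e = 0 := by rw [sub_mul, one_mul, he.eq, sub_self]
  have hsmall (P : Ideal A) (hJP : J ≤ P) (hf : 1 - e ∈ P) : #(A ⧸ P) < κ := by
    let g : (A ⧸ J) →ₗ[A] (A ⧸ P) := Submodule.factor hJP
    refine (Cardinal.mk_le_of_surjective (f := fun x : U ↦ g x) fun q ↦ ?_).trans_lt hU
    obtain ⟨r, rfl⟩ := Submodule.Quotient.mk_surjective _ q
    refine ⟨⟨r • Ideal.Quotient.mk J e, U.smul_mem r huU⟩, ?_⟩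
    refine (Submodule.Quotient.eq P).mpr (?_ : r * e - r ∈ P)
    rw [show r * e - r = -r * (1 - e) by noncomm_ring]
    exact P.mul_mem_left _ hf
  have hlarge (P : Ideal A) [P.IsTwoSided] (hP : P ≠ ⊤) (hmem : e ∈ P) : ¬ #(A ⧸ P) < κ := by
    obtain ⟨m, hm, hPm⟩ := P.exists_le_maximal hP
    have : IsSimpleModule A (A ⧸ m) := isSimpleModule_iff_isCoatom.mpr hm.out
    intro hlt
    have hlt' : #(A ⧸ m) < κ := (Cardinal.mk_le_of_surjective
      (f := (Submodule.factor hPm : (A ⧸ P) →ₗ[A] (A ⧸ m)))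
      (Submodule.factor_surjective hPm)).trans_lt hlt
    have h1 := (hsimple (A ⧸ m)).1 hlt' (Submodule.Quotient.mk 1)
    rw [← Submodule.Quotient.mk_smul, Submodule.Quotient.mk_eq_zero, smul_eq_mul, mul_one] at h1
    refine hm.ne_top ((Ideal.eq_top_iff_one m).mpr ?_)
    simpa using m.add_mem h1 (hPm hmem)
  have hefz (s : A) : e * s * (1 - e) = 0 := by
    by_contra hs
    obtain ⟨P, P', hP2, hP'2, hJP, hJP', hP, hP', hfP, heP', h⟩ :=
      exists_linked_ideals hJ hfe hec hfc hs
    exact hlarge P' hP' heP' ((h κ hκ).mp (hsmall P hJP hfP))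
  have hfez (s : A) : (1 - e) * s * e = 0 := by
    by_contra hs
    obtain ⟨P, P', hP2, hP'2, hJP, hJP', hP, hP', heP, hfP', h⟩ :=
      exists_linked_ideals hJ hef hfc hec hs
    exact hlarge P hP heP ((h κ hκ).mpr (hsmall P' hJP' hfP'))
  have hcenter : e ∈ Set.center A := by
    rw [Semigroup.mem_center_iff]
    intro s
    have h1 : e * s - e * s * e = 0 := by simpa [mul_sub] using hefz s
    have h2 : s * e - e * s * e = 0 := by simpa [sub_mul] using hfez s
    rw [sub_eq_zero.mp h1, sub_eq_zero.mp h2]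
  by_contra hT
  rcases hind e he hcenter with rfl | rfl
  · have := IsSimpleModule.nontrivial A S
    obtain ⟨x, hx⟩ := exists_ne (0 : S)
    exact hx (by simpa using (hsimple S).1 hS x)
  · have := IsSimpleModule.nontrivial A T
    obtain ⟨x, hx⟩ := exists_ne (0 : T)
    exact hx (by simpa using (hsimple T).2 (not_lt.mp hT) x)

theorem TwoSidedIdeal.isUnit_one_add_of_mem_jacobson_bot {R : Type*} [Ring R] {x : R}
    (hx : x ∈ (⊥ : TwoSidedIdeal R).jacobson) : IsUnit (1 + x) := by
  have key : ∀ y ∈ (⊥ : TwoSidedIdeal R).jacobson, ∃ z, z * (1 + y) = 1 := fun y hy ↦ by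
    obtain ⟨z, hz⟩ := TwoSidedIdeal.mem_jacobson_iff.mp hy 1
    rw [TwoSidedIdeal.mem_bot, mul_one, sub_eq_zero] at hz
    exact ⟨z, by rw [mul_add, mul_one, add_comm, hz]⟩
  obtain ⟨z, hz⟩ := key x hx
  have hz' : z = 1 + -(z * x) := by rw [← hz]; noncomm_ring
  obtain ⟨w, hw⟩ := key (-(z * x)) (TwoSidedIdeal.neg_mem _ (TwoSidedIdeal.mul_mem_left _ _ _ hx))
  rw [← hz'] at hw
  have hwx : w = 1 + x := left_inv_eq_right_inv hw hz
  exact ⟨⟨1 + x, z, hwx ▸ hw, hz⟩, rfl⟩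

/-- The Jacobson radical as an ideal of the opposite ring. -/
def opJacobson (R : Type*) [Ring R] : Ideal Rᵐᵒᵖ :=
  (TwoSidedIdeal.asIdeal (⊥ : TwoSidedIdeal R).jacobson).toAddSubgroup.opIdeal
    fun x hx r ↦ by
      simp only [Submodule.mem_toAddSubgroup, TwoSidedIdeal.mem_asIdeal] at hx ⊢
      exact TwoSidedIdeal.mul_mem_right _ _ _ hx

theorem mem_opJacobson {R : Type*} [Ring R] {x : Rᵐᵒᵖ} :
    x ∈ opJacobson R ↔ x.unop ∈ (⊥ : TwoSidedIdeal R).jacobson :=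
  (TwoSidedIdeal.mem_asIdeal (I := (⊥ : TwoSidedIdeal R).jacobson) (x := x.unop) :)

instance {R : Type*} [Ring R] : (opJacobson R).IsTwoSided where
  mul_mem_of_left _ hx :=
    mem_opJacobson.mpr (TwoSidedIdeal.mul_mem_left _ _ _ (mem_opJacobson.mp hx))

theorem isSemisimpleRing_quotient_opJacobson {R : Type*} [Ring R]
    (h : IsSemisimpleRing ((⊥ : TwoSidedIdeal R).jacobson.ringCon.Quotient)) :
    IsSemisimpleRing (Rᵐᵒᵖ ⧸ opJacobson R) := by
  rw [← isSemisimpleRing_mulOpposite_iff]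
  let f : R →+* (Rᵐᵒᵖ ⧸ opJacobson R)ᵐᵒᵖ :=
    (Ideal.Quotient.mk (opJacobson R)).op.comp (RingEquiv.opOp R).toRingHom
  have hf : Function.Surjective f := fun y ↦ by
    obtain ⟨x, hx⟩ := Ideal.Quotient.mk_surjective y.unop
    exact ⟨x.unop, congr_arg MulOpposite.op hx⟩
  have hker : (⊥ : TwoSidedIdeal R).jacobson.ringCon ≤ RingCon.ker f := fun x y hxy ↦ by
    refine congr_arg MulOpposite.op (Ideal.Quotient.eq.mpr ?_)
    exact mem_opJacobson.mpr ((TwoSidedIdeal.rel_iff _ _ _).mp hxy)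
  exact (RingCon.lift _ f hker).isSemisimpleRing_of_surjective
    (RingCon.lift_surjective_of_surjective hker hf)

/-- Over an indecomposable semiperfect left and right noetherian ring, any two
simple right modules are either both finite or have the same infinite cardinality. -/
theorem simple_cardinalities_of_indecomposable (R : Type u) [Ring R]
    (hsp : IsSemiperfectRing R)
    (hln : IsNoetherianRing R) (hrn : IsNoetherianRing Rᵐᵒᵖ)
    (hind : IsIndecomposableRing R)
    (S T : Type u) [AddCommGroup S] [Module Rᵐᵒᵖ S] [AddCommGroup T] [Module Rᵐᵒᵖ T]
    (hS : IsSimpleModule Rᵐᵒᵖ S) (hT : IsSimpleModule Rᵐᵒᵖ T) :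
    (Finite S ∧ Finite T) ∨
      (Infinite S ∧ Infinite T ∧ Cardinal.mk S = Cardinal.mk T) := by
  have := isSemisimpleRing_quotient_opJacobson hsp.1
  have : IsNoetherianRing Rᵐᵒᵖᵐᵒᵖ := isNoetherianRing_of_ringEquiv R (RingEquiv.opOp R)
  have hlift (a : Rᵐᵒᵖ) (ha : a * a - a ∈ opJacobson R) :
      ∃ e : Rᵐᵒᵖ, IsIdempotentElem e ∧ e - a ∈ opJacobson R := by
    obtain ⟨e, he, hea⟩ := hsp.2 a.unop (mem_opJacobson.mp ha)
    exact ⟨.op e, congr_arg MulOpposite.op he, mem_opJacobson.mpr hea⟩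
  have hind' (e : Rᵐᵒᵖ) (he : IsIdempotentElem e) (hc : e ∈ Set.center Rᵐᵒᵖ) : e = 0 ∨ e = 1 := by
    have hc' : e.unop ∈ Set.center R := Semigroup.mem_center_iff.mpr fun r ↦
      (congr_arg MulOpposite.unop (Semigroup.mem_center_iff.mp hc (.op r))).symm
    simpa using hind.2 e.unop (congr_arg MulOpposite.unop he) hc'
  have hunit (x : Rᵐᵒᵖ) (hx : x ∈ opJacobson R) : IsUnit (1 + x) :=
    (TwoSidedIdeal.isUnit_one_add_of_mem_jacobson_bot (mem_opJacobson.mp hx)).op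
  have key (κ : Cardinal.{u}) (hκ : ℵ₀ ≤ κ) : #S < κ ↔ #T < κ :=
    ⟨mk_simple_lt_of_mk_simple_lt hunit hlift hind' hκ S T,
      mk_simple_lt_of_mk_simple_lt hunit hlift hind' hκ T S⟩
  rcases lt_or_ge #S ℵ₀ with hfin | hinf
  · exact .inl ⟨Cardinal.lt_aleph0_iff_finite.mp hfin,
      Cardinal.lt_aleph0_iff_finite.mp ((key _ le_rfl).mp hfin)⟩
  · have hinf' : ℵ₀ ≤ #T := not_lt.mp fun h ↦ hinf.not_gt ((key _ le_rfl).mpr h)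
    refine .inr ⟨Cardinal.infinite_iff.mpr hinf, Cardinal.infinite_iff.mpr hinf', le_antisymm ?_ ?_⟩
    · exact not_lt.mp fun h ↦ lt_irrefl _ ((key _ hinf).mpr h)
    · exact not_lt.mp fun h ↦ lt_irrefl _ ((key _ hinf').mp h)
end

section
/- Let R be an indecomposable semiperfect ring that is left noetherian and right noetherian, and suppose no simple right R-module is finite. Then there exists an infinite cardinal κ such that every nonzero right R-module of finite length has cardinality κ, and moreover the endomorphism ring End_R(S) of every simple right R-module S has cardinality κ. -/
universe u

open Cardinal

/-- A finite product of matrix rings over the division rings `D i`. -/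
abbrev PiMatrix {ι : Type} (d : ι → ℕ) (D : ι → Type u) : Type u :=
  ∀ i, Matrix (Fin (d i)) (Fin (d i)) (D i)

lemma mk_pi_le_of_finite {ι : Type} [Finite ι] {X : ι → Type u} {κ : Cardinal.{u}} (hκ : ℵ₀ ≤ κ)
    (h : ∀ i, #(X i) ≤ κ) : #(∀ i, X i) ≤ κ := by
  have := Fintype.ofFinite ι
  rw [mk_pi]
  refine (prod_le_prod _ (fun _ ↦ κ) h).trans ?_
  rw [prod_const]
  simp only [mk_fintype, lift_natCast, lift_uzero]
  exact power_nat_le hκ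

namespace PiMatrix

variable {ι : Type} [DecidableEq ι] {d : ι → ℕ} {D : ι → Type u} [∀ i, DivisionRing (D i)]

/-- The element with single nonzero entry `x`, in row `j` and column `k` of the block `i`. -/
def unit (i : ι) (j k : Fin (d i)) (x : D i) : PiMatrix d D :=
  Pi.single i (Matrix.single j k x)

lemma unit_mul_unit (i : ι) (j k l : Fin (d i)) (x y : D i) :
    (unit i j k x * unit i k l y : PiMatrix d D) = unit i j l (x * y) := by
  simp [unit, ← Pi.single_mul]

lemma unit_sub (i : ι) (j k : Fin (d i)) (x y : D i) :
    (unit i j k (x - y) : PiMatrix d D) = unit i j k x - unit i j k y := by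
  have h : Matrix.single j k (x - y) = Matrix.single j k x - Matrix.single j k y := by
    simpa using map_sub (Matrix.singleAddMonoidHom j k) x y
  rw [unit, h, Pi.single_sub, unit, unit]

lemma unit_mul_mul_unit (i : ι) (j k l m : Fin (d i)) (x y : D i) (b : PiMatrix d D) :
    unit i j k x * b * unit i l m y = unit i j m (x * b i k l * y) := by
  rw [unit, unit, unit]
  ext i' p q
  by_cases h : i' = i
  · subst h
    simp [Matrix.single_mul_mul_single]
  · simp [h]

lemma eq_zero_of_unit_mul_mul_unit (i : ι) (m : Fin (d i)) (b : PiMatrix d D)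
    (h : ∀ k, b i k m = 0) (y : D i) : b * unit i m m y = 0 := by
  rw [unit]
  ext i' p q
  by_cases hi : i' = i
  · subst hi
    by_cases hq : q = m
    · subst hq; simp [h]
    · simp [hq]
  · simp [hi]

lemma sum_unit [Fintype ι] : ∑ i, ∑ j, (unit i j j 1 : PiMatrix d D) = 1 := by
  have h (i : ι) : ∑ j, (unit i j j 1 : PiMatrix d D) = Pi.single i 1 := by
    simp only [unit]
    rw [← Matrix.sum_single_one]
    exact (map_sum (AddMonoidHom.single (fun i ↦ Matrix (Fin (d i)) (Fin (d i)) (D i)) i) _ _).symm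
  simp only [h]
  exact Finset.univ_sum_single (1 : PiMatrix d D)

variable {N : Type u} [AddCommGroup N]

section Module

variable [Module (PiMatrix d D) N]

lemma exists_unit_smul_ne_zero [Fintype ι] {n : N} (hn : n ≠ 0) :
    ∃ i j, (unit i j j 1 : PiMatrix d D) • n ≠ 0 := by
  by_contra! h
  apply hn
  rw [← one_smul (PiMatrix d D) n, ← sum_unit]
  simp [Finset.sum_smul, h]

lemma unit_smul_injective {i : ι} {j : Fin (d i)} {n : N}
    (hn : (unit i j j 1 : PiMatrix d D) • n ≠ 0) :
    Function.Injective fun x : D i ↦ (unit i j j x : PiMatrix d D) • n := by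
  intro x y hxy
  by_contra hne
  apply hn
  have h0 : (unit i j j (x - y) : PiMatrix d D) • n = 0 := by
    rw [unit_sub, sub_smul, sub_eq_zero]; exact hxy
  rw [← inv_mul_cancel₀ (sub_ne_zero.2 hne), ← unit_mul_unit i j j j, mul_smul, h0, smul_zero]

end Module

variable (d D N)

lemma exists_mk_le_mk [Fintype ι] [Module (PiMatrix d D) N] [Nontrivial N] : ∃ i, #(D i) ≤ #N := by
  obtain ⟨n, hn⟩ := exists_ne (0 : N)
  obtain ⟨i, j, h⟩ := exists_unit_smul_ne_zero (d := d) (D := D) hn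
  exact ⟨i, mk_le_of_injective (unit_smul_injective h)⟩

lemma exists_mk_le_mk_end [Fintype ι] [Module (PiMatrix d D) N] [IsSimpleModule (PiMatrix d D) N] :
    ∃ i, #(D i) ≤ #(Module.End (PiMatrix d D) N) := by
  have := IsSimpleModule.nontrivial (PiMatrix d D) N
  obtain ⟨n, hn⟩ := exists_ne (0 : N)
  obtain ⟨i, j, hm⟩ := exists_unit_smul_ne_zero (d := d) (D := D) hn
  set m := (unit i j j 1 : PiMatrix d D) • n with hm'
  have key (x : D i) : ∃ f : Module.End (PiMatrix d D) N, f m = (unit i j j x : PiMatrix d D) • n := by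
    have hle : LinearMap.ker (LinearMap.toSpanSingleton (PiMatrix d D) N m) ≤
        LinearMap.ker (LinearMap.toSpanSingleton (PiMatrix d D) N
          ((unit i j j x : PiMatrix d D) • n)) := by
      intro b hb
      simp only [LinearMap.mem_ker, LinearMap.toSpanSingleton_apply] at hb ⊢
      rw [← mul_smul, eq_zero_of_unit_mul_mul_unit, zero_smul]
      intro k
      by_contra hk
      apply hm
      have h1 := unit_mul_mul_unit i j k j j (b i k j)⁻¹ 1 b
      rw [inv_mul_cancel₀ hk, one_mul] at h1
      rw [hm', ← h1, mul_smul, mul_smul, ← hm', hb, smul_zero]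
    have hs := IsSimpleModule.toSpanSingleton_surjective (PiMatrix d D) hm
    refine ⟨(Submodule.liftQ _ _ hle) ∘ₗ
      (LinearMap.quotKerEquivOfSurjective _ hs).symm.toLinearMap, ?_⟩
    have h1 : (LinearMap.quotKerEquivOfSurjective _ hs).symm m = Submodule.Quotient.mk 1 := by
      rw [LinearEquiv.symm_apply_eq]
      simp
    simp [h1]
  choose f hf using key
  refine ⟨i, mk_le_of_injective (f := f) fun x y hxy ↦ ?_⟩
  refine unit_smul_injective hm ?_
  simp only [← hf, hxy]

omit [DecidableEq ι] [∀ i, DivisionRing (D i)] in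
lemma mk_le [Finite ι] {κ : Cardinal.{u}} (hκ : ℵ₀ ≤ κ) (h : ∀ i, #(D i) ≤ κ) :
    #(PiMatrix d D) ≤ κ := by
  have h1 (i : ι) : #(Matrix (Fin (d i)) (Fin (d i)) (D i)) ≤ κ :=
    mk_pi_le_of_finite hκ fun _ ↦ mk_pi_le_of_finite hκ fun _ ↦ h i
  exact mk_pi_le_of_finite hκ h1

end PiMatrix

lemma mk_le_of_module_finite {A N : Type u} [Ring A] [AddCommGroup N] [Module A N]
    [Module.Finite A N] {κ : Cardinal.{u}} (hκ : ℵ₀ ≤ κ) (h : #A ≤ κ) : #N ≤ κ := by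
  obtain ⟨n, f, hf⟩ := Module.Finite.exists_fin' A N
  exact (mk_le_of_surjective hf).trans (mk_pi_le_of_finite hκ fun _ ↦ h)

section Surjective

variable {A B N : Type u} [Ring A] [Ring B] [AddCommGroup N] [Module A N] (φ : A →+* B)

lemma exists_module_of_surjective (hφ : Function.Surjective φ)
    (hN : ∀ a, φ a = 0 → ∀ n : N, a • n = 0) :
    ∃ _ : Module B N, ∀ a (n : N), φ a • n = a • n := by
  let _ : SMul B N := ⟨fun b n ↦ Function.surjInv hφ b • n⟩
  have h (a : A) (n : N) : φ a • n = a • n := by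
    rw [← sub_eq_zero]
    change Function.surjInv hφ (φ a) • n - a • n = 0
    rw [← sub_smul]
    exact hN _ (by rw [map_sub, Function.surjInv_eq hφ, sub_self]) n
  exact ⟨hφ.moduleLeft φ h, h⟩

variable [Module B N] (hφ : Function.Surjective φ) (h : ∀ a (n : N), φ a • n = a • n)
include hφ h

lemma module_finite_of_surjective [Module.Finite A N] : Module.Finite B N := by
  have : RingHomSurjective φ := ⟨hφ⟩
  let l : N →ₛₗ[φ] N := { AddMonoidHom.id N with map_smul' := fun a n ↦ (h a n).symm }
  exact Module.Finite.of_surjective l Function.surjective_id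

lemma isSimpleModule_of_surjective [IsSimpleModule A N] : IsSimpleModule B N := by
  have : RingHomSurjective φ := ⟨hφ⟩
  let l : N →ₛₗ[φ] N := { AddMonoidHom.id N with map_smul' := fun a n ↦ (h a n).symm }
  exact (LinearMap.isSimpleModule_iff_of_bijective l Function.bijective_id).1 inferInstance

omit hφ in
lemma mk_end_le_of_surjective : #(Module.End B N) ≤ #(Module.End A N) := by
  refine mk_le_of_injective
    (f := fun g ↦ { g.toAddMonoidHom with map_smul' := fun a n ↦ ?_ }) fun g g' hg ↦ ?_
  · change g (a • n) = a • g n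
    rw [← h, ← h, map_smul]
  · ext n
    exact congr($hg n)

end Surjective

lemma mk_end_le_mk {A S : Type u} [Ring A] [AddCommGroup S] [Module A S] [IsSimpleModule A S] :
    #(Module.End A S) ≤ #S := by
  have := IsSimpleModule.nontrivial A S
  obtain ⟨s, hs⟩ := exists_ne (0 : S)
  refine mk_le_of_injective (f := fun g ↦ g s) fun g g' hg ↦ ?_
  ext t
  obtain ⟨a, rfl⟩ := IsSimpleModule.toSpanSingleton_surjective A hs t
  simp only [LinearMap.toSpanSingleton_apply, map_smul]
  exact congr(a • $hg)

lemma finite_quotient_of_surjective {A B : Type u} [Ring A] [Ring B] [Finite B] (φ : A →+* B)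
    (hφ : Function.Surjective φ) {I : Ideal A} (hI : RingHom.ker φ ≤ I) : Finite (A ⧸ I) := by
  refine Finite.of_surjective
    (fun b ↦ (Submodule.Quotient.mk (Function.surjInv hφ b) : A ⧸ I)) fun x ↦ ?_
  obtain ⟨a, rfl⟩ := Submodule.Quotient.mk_surjective _ x
  refine ⟨φ a, (Submodule.Quotient.eq _).2 (hI ?_)⟩
  rw [RingHom.mem_ker, map_sub, Function.surjInv_eq hφ, sub_self]

/-- A ring with a nontrivial finite quotient has a finite simple module. -/
lemma exists_finite_simple_module {A B : Type u} [Ring A] [Ring B] [Finite B] [Nontrivial B]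
    (φ : A →+* B) (hφ : Function.Surjective φ) :
    ∃ (S : Type u) (_ : AddCommGroup S) (_ : Module A S), IsSimpleModule A S ∧ Finite S := by
  obtain ⟨m, hm, hle⟩ := Ideal.exists_le_maximal (RingHom.ker φ) (RingHom.ker_ne_top φ)
  exact ⟨A ⧸ m, inferInstance, inferInstance, isSimpleModule_iff_isCoatom.2 hm.out,
    finite_quotient_of_surjective φ hφ hle⟩

section Cardinality

variable {ι : Type} [Finite ι] {d : ι → ℕ} {D : ι → Type u} [∀ i, DivisionRing (D i)]
  {A N : Type u} [Ring A] [AddCommGroup N] [Module A N] {φ : A →+* PiMatrix d D}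
  (hφ : Function.Surjective φ) {κ : Cardinal.{u}}
include hφ

lemma le_mk_of_surjective_piMatrix [Nontrivial N] (hN : ∀ a, φ a = 0 → ∀ n : N, a • n = 0)
    (h : ∀ i, κ ≤ #(D i)) : κ ≤ #N := by
  classical
  have := Fintype.ofFinite ι
  obtain ⟨_, -⟩ := exists_module_of_surjective φ hφ hN
  obtain ⟨i, hi⟩ := PiMatrix.exists_mk_le_mk d D N
  exact (h i).trans hi

lemma mk_le_of_surjective_piMatrix [Module.Finite A N] (hN : ∀ a, φ a = 0 → ∀ n : N, a • n = 0)
    (hκ : ℵ₀ ≤ κ) (h : ∀ i, #(D i) ≤ κ) : #N ≤ κ := by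
  obtain ⟨_, hs⟩ := exists_module_of_surjective φ hφ hN
  have := module_finite_of_surjective φ hφ hs
  exact mk_le_of_module_finite hκ (PiMatrix.mk_le d D hκ h)

lemma le_mk_end_of_surjective_piMatrix [IsSimpleModule A N]
    (hN : ∀ a, φ a = 0 → ∀ n : N, a • n = 0) (h : ∀ i, κ ≤ #(D i)) :
    κ ≤ #(Module.End A N) := by
  classical
  have := Fintype.ofFinite ι
  obtain ⟨_, hs⟩ := exists_module_of_surjective φ hφ hN
  have := isSimpleModule_of_surjective φ hφ hs
  obtain ⟨i, hi⟩ := PiMatrix.exists_mk_le_mk_end d D N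
  exact ((h i).trans hi).trans (mk_end_le_of_surjective φ hs)

omit [Finite ι] in
/-- A module on which the idempotent of the blocks in `p` acts as the identity is a module over
the product of these blocks. -/
lemma exists_surjective_piMatrix_subtype {p : ι → Prop} [DecidablePred p]
    (hN : ∀ a, φ a = 0 → ∀ n : N, a • n = 0) {e : A} (he : φ e = fun i ↦ if p i then 1 else 0)
    (heN : ∀ n : N, e • n = n) :
    ∃ ψ : A →+* PiMatrix (fun i : {i // p i} ↦ d i) (fun i ↦ D i),
      Function.Surjective ψ ∧ ∀ a, ψ a = 0 → ∀ n : N, a • n = 0 := by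
  refine ⟨RingHom.pi fun i ↦ (Pi.evalRingHom _ i.1).comp φ, fun y ↦ ?_, fun a ha n ↦ ?_⟩
  · obtain ⟨a, ha⟩ := hφ fun i ↦ if hi : p i then y ⟨i, hi⟩ else 0
    refine ⟨a, funext fun i ↦ ?_⟩
    change φ a i = y i
    simp [ha, i.2]
  · rw [← heN n, ← mul_smul]
    apply hN
    rw [map_mul, he]
    funext i
    by_cases hi : p i
    · have : φ a i = 0 := congr_fun ha ⟨i, hi⟩
      simp [hi, this]
    · simp [hi]

lemma le_mk_of_idempotent {p : ι → Prop} [DecidablePred p] [Nontrivial N]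
    (hN : ∀ a, φ a = 0 → ∀ n : N, a • n = 0) {e : A} (he : φ e = fun i ↦ if p i then 1 else 0)
    (heN : ∀ n : N, e • n = n) (h : ∀ i, p i → κ ≤ #(D i)) : κ ≤ #N := by
  obtain ⟨ψ, hψ, hψN⟩ := exists_surjective_piMatrix_subtype hφ hN he heN
  exact le_mk_of_surjective_piMatrix hψ hψN fun i ↦ h i i.2

lemma mk_le_of_idempotent {p : ι → Prop} [DecidablePred p] [Module.Finite A N]
    (hN : ∀ a, φ a = 0 → ∀ n : N, a • n = 0) {e : A} (he : φ e = fun i ↦ if p i then 1 else 0)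
    (heN : ∀ n : N, e • n = n) (hκ : ℵ₀ ≤ κ) (h : ∀ i, p i → #(D i) ≤ κ) : #N ≤ κ := by
  obtain ⟨ψ, hψ, hψN⟩ := exists_surjective_piMatrix_subtype hφ hN he heN
  exact mk_le_of_surjective_piMatrix hψ hψN hκ fun i ↦ h i i.2

end Cardinality

/-- A nonzero bimodule, finitely generated on both sides, is not the sum of its products with the
two Jacobson radicals. -/
lemma exists_common_quotient {A C M : Type u} [Ring A] [Ring C] [AddCommGroup M] [Module A M]
    [Module C M] [SMulCommClass A C M] [Module.Finite A M] [Module.Finite C M] [Nontrivial M]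
    {I : Ideal A} (hI : I ≤ Ring.jacobson A) {K : Ideal C} (hK : K ≤ Ring.jacobson C) :
    ∃ (P : Submodule A M) (Q : Submodule C M), P.toAddSubgroup = Q.toAddSubgroup ∧ P ≠ ⊤ ∧
      (∀ a ∈ I, ∀ m : M, a • m ∈ P) ∧ ∀ c ∈ K, ∀ m : M, c • m ∈ Q := by
  let P₁ : Submodule A M := I • ⊤
  let Q₁ : Submodule C M := K • ⊤
  let P₂ : Submodule A M :=
    { Q₁.toAddSubgroup with
      smul_mem' := fun a x hx ↦ by
        refine Submodule.smul_induction_on (p := fun x ↦ a • x ∈ Q₁) hx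
          (fun c hc m _ ↦ ?_) fun x y hx hy ↦ ?_
        · rw [smul_comm]
          exact Submodule.smul_mem_smul hc Submodule.mem_top
        · rw [smul_add]
          exact add_mem hx hy }
  let Q₂ : Submodule C M :=
    { P₁.toAddSubgroup with
      smul_mem' := fun c x hx ↦ by
        refine Submodule.smul_induction_on (p := fun x ↦ c • x ∈ P₁) hx
          (fun a ha m _ ↦ ?_) fun x y hx hy ↦ ?_
        · rw [← smul_comm]
          exact Submodule.smul_mem_smul ha Submodule.mem_top
        · rw [smul_add]
          exact add_mem hx hy }
  have hP₂ : P₂ ≠ ⊤ := by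
    intro h
    have h1 : Q₁ < ⊤ := (Submodule.smul_mono_left hK).trans_lt
      (Submodule.FG.jacobson_smul_lt top_ne_bot Module.Finite.fg_top)
    refine h1.ne (Submodule.ext fun x ↦ ?_)
    have : x ∈ P₂ := h ▸ Submodule.mem_top
    exact iff_of_true this trivial
  refine ⟨P₁ ⊔ P₂, Q₂ ⊔ Q₁, ?_, ?_, fun a ha m ↦ ?_, fun c hc m ↦ ?_⟩
  · rw [Submodule.sup_toAddSubgroup, Submodule.sup_toAddSubgroup]
  · have := Submodule.Quotient.nontrivial_iff.2 hP₂
    have h1 : I • (⊤ : Submodule A (M ⧸ P₂)) < ⊤ := (Submodule.smul_mono_left hI).trans_lt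
      (Submodule.FG.jacobson_smul_lt top_ne_bot Module.Finite.fg_top)
    intro h
    refine h1.ne (eq_top_iff.2 ?_)
    rw [sup_comm, ← Submodule.map_mkQ_eq_top, Submodule.map_smul'', Submodule.map_top,
      Submodule.range_mkQ] at h
    exact h.ge
  · exact Submodule.mem_sup_left (Submodule.smul_mem_smul ha Submodule.mem_top)
  · exact Submodule.mem_sup_right (Submodule.smul_mem_smul hc Submodule.mem_top)

open MulOpposite

lemma op_mem_jacobson {R : Type u} [Ring R] {x : R} (hx : x ∈ Ring.jacobson R) :
    op x ∈ Ring.jacobson Rᵐᵒᵖ := by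
  have h (u : R) (hu : u ∈ Ring.jacobson R) : ∃ z, z * (1 + u) = 1 := by
    rw [← Ideal.jacobson_bot, Ideal.mem_jacobson_iff] at hu
    obtain ⟨z, hz⟩ := hu 1
    refine ⟨z, ?_⟩
    rw [Submodule.mem_bot, sub_eq_zero, mul_one] at hz
    rw [mul_add, mul_one, add_comm, hz]
  rw [← Ideal.jacobson_bot, Ideal.mem_jacobson_iff]
  intro y
  have hu : x * y.unop ∈ Ring.jacobson R := Ideal.mul_mem_right _ _ hx
  obtain ⟨z, hz⟩ := h _ hu
  obtain ⟨w, hw⟩ := h _ (neg_mem (Ideal.mul_mem_left _ z hu))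
  have hz' : 1 + -(z * (x * y.unop)) = z := by
    rw [mul_add, mul_one] at hz
    rw [← hz, add_neg_cancel_right]
  rw [hz'] at hw
  refine ⟨op z, ?_⟩
  rw [Submodule.mem_bot, sub_eq_zero]
  apply unop_injective
  rw [left_inv_eq_right_inv hw hz] at hw
  simp only [unop_add, unop_mul, unop_op, unop_one]
  rw [← mul_assoc, add_comm, ← one_add_mul, hw]

/-- The bimodule generated by `e * r * (1 - e)` has a nonzero quotient annihilated by the Jacobson
radical on both sides, by `1 - e` on the left and by `e` on the right. -/
lemma exists_module_of_mul_mul_ne_zero {R : Type u} [Ring R] [IsNoetherianRing R]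
    [IsNoetherianRing Rᵐᵒᵖ] {e r : R} (he : IsIdempotentElem e)
    (hc : ∀ a, e * a - a * e ∈ Ring.jacobson R) (hr : e * r * (1 - e) ≠ 0) :
    ∃ (N N' : Type u) (_ : AddCommGroup N) (_ : AddCommGroup N') (_ : Module R N)
      (_ : Module Rᵐᵒᵖ N'), #N = #N' ∧ Nontrivial N ∧ Module.Finite R N ∧ Module.Finite Rᵐᵒᵖ N' ∧
      (∀ a ∈ Ring.jacobson R, ∀ n : N, a • n = 0) ∧
      (∀ a ∈ Ring.jacobson R, ∀ n : N', op a • n = 0) ∧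
      (∀ n : N, (1 - e) • n = 0) ∧ ∀ n : N', op e • n = 0 := by
  let T := TwoSidedIdeal.span {e * r * (1 - e)}
  have : Module.Finite R T := .of_injective _ T.subtype_injective
  have : Module.Finite Rᵐᵒᵖ T := .of_injective _ T.subtypeMop_injective
  have : Nontrivial T := by
    refine ⟨⟨⟨_, TwoSidedIdeal.subset_span rfl⟩, 0, fun h ↦ hr congr(($h : R))⟩⟩
  let K : Ideal Rᵐᵒᵖ :=
    { carrier := {a | a.unop ∈ Ring.jacobson R}
      add_mem' := fun ha hb ↦ (Ring.jacobson R).add_mem ha hb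
      zero_mem' := (Ring.jacobson R).zero_mem
      smul_mem' := fun c a ha ↦ by
        change a.unop * c.unop ∈ Ring.jacobson R
        exact Ideal.mul_mem_right _ _ ha }
  obtain ⟨P, Q, hPQ, hP, hJ, hK⟩ := exists_common_quotient (M := T) (le_refl (Ring.jacobson R))
    (K := K) fun a ha ↦ op_mem_jacobson ha
  have hmem (x : T) : x ∈ P ↔ x ∈ Q := by
    rw [← Submodule.mem_toAddSubgroup, hPQ, Submodule.mem_toAddSubgroup]
  have h1 : ∀ x : T, (1 - e) • x ∈ P := by
    rintro ⟨x, hx⟩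
    refine TwoSidedIdeal.span_induction (p := fun x hx ↦ (1 - e) • (⟨x, hx⟩ : T) ∈ P)
      (fun x hx ↦ ?_) ?_ (fun x y hx hy h h' ↦ ?_) (fun x hx h ↦ ?_) (fun a x hx h ↦ ?_)
      (fun b x hx h ↦ ?_) hx
    · obtain rfl := hx
      convert P.zero_mem
      ext
      simp [← mul_assoc, sub_mul, he.eq]
    · convert P.zero_mem
      ext
      simp
    · convert P.add_mem h h' using 1
      ext
      simp [mul_add]
    · convert P.neg_mem h using 1
      ext
      simp
    · have h2 : (1 - e) * a * e ∈ Ring.jacobson R := by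
        have := Ideal.mul_mem_right e _ (neg_mem (hc a))
        convert this using 1
        simp only [neg_sub, sub_mul, one_mul, mul_assoc, he.eq]
      convert P.add_mem (P.smul_mem ((1 - e) * a) h) (hJ _ h2 ⟨x, hx⟩) using 1
      ext
      simp
      noncomm_ring
    · rw [hmem] at h ⊢
      convert Q.smul_mem (op b) h using 1
      exact Subtype.ext (mul_assoc _ _ _).symm
  have h2 : ∀ x : T, op e • x ∈ Q := by
    rintro ⟨x, hx⟩
    refine TwoSidedIdeal.span_induction (p := fun x hx ↦ op e • (⟨x, hx⟩ : T) ∈ Q)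
      (fun x hx ↦ ?_) ?_ (fun x y hx hy h h' ↦ ?_) (fun x hx h ↦ ?_) (fun a x hx h ↦ ?_)
      (fun b x hx h ↦ ?_) hx
    · obtain rfl := hx
      convert Q.zero_mem
      ext
      change e * r * (1 - e) * e = 0
      rw [mul_assoc, sub_mul, one_mul, he.eq, sub_self, mul_zero]
    · convert Q.zero_mem
      exact Subtype.ext (zero_mul e)
    · convert Q.add_mem h h' using 1
      exact Subtype.ext (add_mul _ _ _)
    · convert Q.neg_mem h using 1
      exact Subtype.ext (neg_mul _ _)
    · rw [← hmem] at h ⊢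
      convert P.smul_mem a h using 1
      exact Subtype.ext (mul_assoc _ _ _)
    · have h2 : (1 - e) * b * e ∈ Ring.jacobson R := by
        have := Ideal.mul_mem_right e _ (neg_mem (hc b))
        convert this using 1
        simp only [neg_sub, sub_mul, one_mul, mul_assoc, he.eq]
      convert Q.add_mem (Q.smul_mem (op (b * e)) h) (hK (op ((1 - e) * b * e)) h2 ⟨x, hx⟩) using 1
      ext
      change x * b * e = x * e * (b * e) + x * ((1 - e) * b * e)
      noncomm_ring
  refine ⟨T ⧸ P, T ⧸ Q, inferInstance, inferInstance, inferInstance, inferInstance, ?_,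
    Submodule.Quotient.nontrivial_iff.2 hP, inferInstance, inferInstance, fun a ha n ↦ ?_,
    fun a ha n ↦ ?_, fun n ↦ ?_, fun n ↦ ?_⟩
  · change #(T ⧸ P.toAddSubgroup) = #(T ⧸ Q.toAddSubgroup)
    rw [hPQ]
  all_goals
    obtain ⟨n, rfl⟩ := Submodule.Quotient.mk_surjective _ n
    rw [← Submodule.Quotient.mk_smul, Submodule.Quotient.mk_eq_zero]
  · exact hJ a ha n
  · exact hK (op a) ha n
  · exact h1 n
  · exact h2 n

section Opposite

variable {ι : Type} {d : ι → ℕ} {D : ι → Type u} [∀ i, DivisionRing (D i)] {R : Type u} [Ring R]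

/-- The map from the opposite ring to the opposite matrix rings, written as matrix rings over the
opposite division rings. -/
def PiMatrix.opHom (φ : R →+* PiMatrix d D) : Rᵐᵒᵖ →+* PiMatrix d fun i ↦ (D i)ᵐᵒᵖ :=
  RingHom.pi fun i ↦ RingEquiv.mopMatrix.symm.toRingHom.comp
    (RingHom.op ((Pi.evalRingHom _ i).comp φ))

lemma PiMatrix.opHom_apply (φ : R →+* PiMatrix d D) (a : Rᵐᵒᵖ) (i : ι) :
    opHom φ a i = RingEquiv.mopMatrix.symm (op (φ a.unop i)) := rfl

lemma PiMatrix.opHom_surjective {φ : R →+* PiMatrix d D} (hφ : Function.Surjective φ) :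
    Function.Surjective (opHom φ) := by
  intro y
  obtain ⟨a, ha⟩ := hφ fun i ↦ (RingEquiv.mopMatrix (y i)).unop
  refine ⟨op a, funext fun i ↦ ?_⟩
  rw [opHom_apply, unop_op, ha, op_unop, RingEquiv.symm_apply_apply]

lemma PiMatrix.opHom_eq_zero {φ : R →+* PiMatrix d D} {a : Rᵐᵒᵖ} (ha : opHom φ a = 0) :
    φ a.unop = 0 := by
  funext i
  have h := congr_fun ha i
  rw [opHom_apply, Pi.zero_apply, map_eq_zero_iff _ (RingEquiv.injective _), op_eq_zero_iff] at h
  exact h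

variable [Finite ι] [IsNoetherianRing R] [IsNoetherianRing Rᵐᵒᵖ] {φ : R →+* PiMatrix d D}

/-- If `e * R * (1 - e)` is nonzero, then the blocks on which `e` is `1` and those on which it is
`0` have common bounds on cardinality. -/
lemma exists_cardinal_of_mul_mul_ne_zero (hφ : Function.Surjective φ)
    (hJ : ∀ a, φ a = 0 ↔ a ∈ Ring.jacobson R) {p : ι → Prop} [DecidablePred p] {e r : R}
    (he : IsIdempotentElem e) (hp : φ e = fun i ↦ if p i then 1 else 0)
    (hr : e * r * (1 - e) ≠ 0) :
    ∃ c : Cardinal.{u}, ∀ κ, ((∀ i, p i → κ ≤ #(D i)) → κ ≤ c) ∧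
      (ℵ₀ ≤ κ → (∀ i, p i → #(D i) ≤ κ) → c ≤ κ) ∧ ((∀ i, ¬ p i → κ ≤ #(D i)) → κ ≤ c) ∧
      (ℵ₀ ≤ κ → (∀ i, ¬ p i → #(D i) ≤ κ) → c ≤ κ) := by
  have hc (a : R) : e * a - a * e ∈ Ring.jacobson R := by
    rw [← hJ, map_sub, map_mul, map_mul, hp, sub_eq_zero]
    funext i
    by_cases hi : p i <;> simp [hi]
  obtain ⟨N, N', _, _, _, _, hcard, _, _, _, hN, hN', heN, heN'⟩ :=
    exists_module_of_mul_mul_ne_zero he hc hr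
  have : Nontrivial N' := by
    rw [← one_lt_iff_nontrivial, ← hcard, one_lt_iff_nontrivial]
    infer_instance
  have hp' : PiMatrix.opHom φ (op (1 - e)) = fun i ↦ if ¬ p i then 1 else 0 := by
    funext i
    rw [PiMatrix.opHom_apply, unop_op, map_sub, map_one, hp]
    by_cases hi : p i <;> simp [hi]
  have hl (n : N) : e • n = n := by
    have := heN n
    rw [sub_smul, one_smul, sub_eq_zero] at this
    exact this.symm
  have hl' (n : N') : op (1 - e) • n = n := by
    rw [op_sub, op_one, sub_smul, one_smul, heN', sub_zero]
  have hk (a : R) (ha : φ a = 0) : ∀ n : N, a • n = 0 := hN a ((hJ a).1 ha)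
  have hk' (a : Rᵐᵒᵖ) (ha : PiMatrix.opHom φ a = 0) : ∀ n : N', a • n = 0 :=
    hN' a.unop ((hJ _).1 (PiMatrix.opHom_eq_zero ha))
  have hφ' := PiMatrix.opHom_surjective hφ
  have hD (i : ι) : #(D i)ᵐᵒᵖ = #(D i) := mk_congr opEquiv.symm
  refine ⟨#N, fun κ ↦ ⟨le_mk_of_idempotent hφ hk hp hl, mk_le_of_idempotent hφ hk hp hl, ?_, ?_⟩⟩
  · intro h
    rw [hcard]
    exact le_mk_of_idempotent hφ' hk' hp' hl' fun i hi ↦ (h i hi).trans_eq (hD i).symm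
  · intro hκ h
    rw [hcard]
    exact mk_le_of_idempotent hφ' hk' hp' hl' hκ fun i hi ↦ (hD i).trans_le (h i hi)

/-- Over an indecomposable ring in which idempotents lift, all blocks have the same cardinality. -/
lemma exists_forall_mk_eq [∀ i, NeZero (d i)] (hind : IsIndecomposableRing R)
    (hφ : Function.Surjective φ) (hJ : ∀ a, φ a = 0 ↔ a ∈ Ring.jacobson R)
    (hlift : ∀ a : R, a * a - a ∈ Ring.jacobson R →
      ∃ e : R, IsIdempotentElem e ∧ e - a ∈ Ring.jacobson R)
    (hinf : ∀ i, ℵ₀ ≤ #(D i)) : ∃ i₀, ∀ i, #(D i) = #(D i₀) := by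
  classical
  have := hind.1
  have : Nonempty ι := by
    by_contra h
    have := not_nonempty_iff.1 h
    exact (Ideal.ne_top_iff_one _).1 (Ring.jacobson_lt_top R).ne
      ((hJ 1).1 (Subsingleton.elim _ _))
  obtain ⟨i₀, hi₀⟩ := Finite.exists_min fun i ↦ #(D i)
  refine ⟨i₀, ?_⟩
  set κ := #(D i₀)
  let p (i : ι) : Prop := #(D i) = κ
  obtain ⟨a, ha⟩ := hφ fun i ↦ if p i then 1 else 0
  obtain ⟨e, he, hea⟩ := hlift a <| by
    rw [← hJ, map_sub, map_mul, ha, sub_eq_zero]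
    funext i
    by_cases hi : p i <;> simp [hi]
  rw [← hJ, map_sub, sub_eq_zero, ha] at hea
  have hle (i : ι) (hi : p i) : #(D i) ≤ κ := le_of_eq hi
  have hlt (i : ι) (hi : ¬ p i) : Order.succ κ ≤ #(D i) :=
    Order.succ_le_of_lt ((hi₀ i).lt_of_ne' hi)
  have hleft (r : R) : e * r * (1 - e) = 0 := by
    by_contra hr
    obtain ⟨c, hc⟩ := exists_cardinal_of_mul_mul_ne_zero hφ hJ he hea hr
    exact (Order.lt_succ κ).not_ge (((hc _).2.2.1 hlt).trans ((hc κ).2.1 (hinf i₀) hle))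
  have hright (r : R) : (1 - e) * r * e = 0 := by
    by_contra hr
    have hea' : φ (1 - e) = fun i ↦ if ¬ p i then 1 else 0 := by
      rw [map_sub, map_one, hea]
      funext i
      by_cases hi : p i <;> simp [hi]
    obtain ⟨c, hc⟩ := exists_cardinal_of_mul_mul_ne_zero hφ hJ he.one_sub hea' (r := r)
      (by rwa [sub_sub_cancel])
    refine (Order.lt_succ κ).not_ge (((hc _).1 hlt).trans ((hc κ).2.2.2 (hinf i₀) ?_))
    simpa using hle
  have hcen : e ∈ Set.center R := by
    rw [Semigroup.mem_center_iff]
    intro r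
    have h1 := hleft r
    have h2 := hright r
    rw [mul_sub, mul_one, sub_eq_zero] at h1
    rw [sub_mul, sub_mul, one_mul, sub_eq_zero] at h2
    rw [h1, h2]
  rcases hind.2 e he hcen with rfl | rfl
  · have := congr_fun hea i₀
    simp [p, κ] at this
  · intro i
    by_contra hi
    have := congr_fun hea i
    simp [p, hi] at this

end Opposite

lemma IsFiniteLength.mk_eq {A : Type u} [Ring A] {κ : Cardinal.{u}} (hκ : ℵ₀ ≤ κ)
    (hS : ∀ (S : Type u) (_ : AddCommGroup S) (_ : Module A S), IsSimpleModule A S → #S = κ)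
    {M : Type u} [AddCommGroup M] [Module A M] (hM : IsFiniteLength A M) [Nontrivial M] :
    #M = κ := by
  suffices #M ≤ κ ∧ (Nontrivial M → κ ≤ #M) from this.1.antisymm (this.2 inferInstance)
  induction hM with
  | @of_subsingleton M _ _ _ =>
    exact ⟨(le_one_iff_subsingleton.2 inferInstance).trans (one_le_aleph0.trans hκ),
      fun h ↦ (not_subsingleton M inferInstance).elim⟩
  | @of_simple_quotient M _ _ N _ _ ih =>
    have h := hS (M ⧸ N) _ _ inferInstance
    refine ⟨?_, fun _ ↦ h.symm.trans_le (mk_le_of_surjective N.mkQ_surjective)⟩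
    rw [mk_congr (AddSubgroup.addGroupEquivQuotientProdAddSubgroup (s := N.toAddSubgroup)),
      mk_prod, lift_id, lift_id]
    exact mul_le_of_le hκ h.le ih.1

lemma smul_eq_zero_of_mem_jacobson {A S : Type u} [Ring A] [AddCommGroup S] [Module A S]
    [IsSimpleModule A S] {a : A} (ha : a ∈ Ring.jacobson A) (s : S) : a • s = 0 := by
  have h := Ring.jacobson_smul_top_le A S (Submodule.smul_mem_smul ha (Submodule.mem_top (x := s)))
  rwa [IsSimpleModule.jacobson_eq_bot, Submodule.mem_bot] at h

/-- A semiperfect ring maps onto a product of matrix rings over division rings, the kernel being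
the Jacobson radical. -/
lemma IsSemiperfectRing.exists_piMatrix {R : Type u} [Ring R] (h : IsSemiperfectRing R) :
    ∃ (n : ℕ) (D : Fin n → Type u) (d : Fin n → ℕ) (_ : ∀ i, DivisionRing (D i))
      (φ : R →+* PiMatrix d D), (∀ i, NeZero (d i)) ∧ Function.Surjective φ ∧
        ∀ a, φ a = 0 ↔ a ∈ Ring.jacobson R := by
  have := h.1
  obtain ⟨n, D, d, _, hd, ⟨E⟩⟩ := IsSemisimpleRing.exists_ringEquiv_pi_matrix_divisionRing
    ((⊥ : TwoSidedIdeal R).jacobson.ringCon.Quotient)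
  refine ⟨n, D, d, _, E.toRingHom.comp (⊥ : TwoSidedIdeal R).jacobson.ringCon.mk', hd,
    E.surjective.comp (RingCon.mk'_surjective _), fun a ↦ ?_⟩
  change E _ = 0 ↔ _
  rw [map_eq_zero_iff _ E.injective, ← TwoSidedIdeal.mem_ker, TwoSidedIdeal.ker_ringCon_mk']
  simp [TwoSidedIdeal.jacobson, Ideal.jacobson_bot]

/-- If no simple right module over an indecomposable semiperfect left and right
noetherian ring is finite, then there is an infinite cardinal `κ` such that every
nonzero right module of finite length has cardinality `κ` and the endomorphism ring
of every simple right module has cardinality `κ`. -/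
theorem exists_cardinal_of_no_finite_simple (R : Type u) [Ring R]
    (hsp : IsSemiperfectRing R)
    (hln : IsNoetherianRing R) (hrn : IsNoetherianRing Rᵐᵒᵖ)
    (hind : IsIndecomposableRing R)
    (hnofin : ∀ (S : Type u) (_ : AddCommGroup S) (_ : Module Rᵐᵒᵖ S),
      IsSimpleModule Rᵐᵒᵖ S → ¬ Finite S) :
    ∃ κ : Cardinal.{u}, Cardinal.aleph0 ≤ κ ∧
      (∀ (M : Type u) (_ : AddCommGroup M) (_ : Module Rᵐᵒᵖ M),
        IsFiniteLength Rᵐᵒᵖ M → Nontrivial M → Cardinal.mk M = κ) ∧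
      (∀ (S : Type u) (_ : AddCommGroup S) (_ : Module Rᵐᵒᵖ S),
        IsSimpleModule Rᵐᵒᵖ S → Cardinal.mk (Module.End Rᵐᵒᵖ S) = κ) := by
  obtain ⟨n, D, d, _, φ, _, hφ, hJ⟩ := hsp.exists_piMatrix
  have hφ' := PiMatrix.opHom_surjective hφ
  have hD (i : Fin n) : #(D i)ᵐᵒᵖ = #(D i) := mk_congr opEquiv.symm
  have hinf (i : Fin n) : ℵ₀ ≤ #(D i) := by
    rw [← not_lt, lt_aleph0_iff_finite]
    intro hfin
    have : Finite (Matrix (Fin (d i)) (Fin (d i)) (D i)ᵐᵒᵖ) :=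
      have : Finite (D i)ᵐᵒᵖ := Finite.of_equiv _ opEquiv
      inferInstanceAs (Finite (Fin (d i) → Fin (d i) → (D i)ᵐᵒᵖ))
    obtain ⟨S, _, _, hS, hS'⟩ := exists_finite_simple_module
      ((Pi.evalRingHom _ i).comp (PiMatrix.opHom φ)) ((Function.surjective_eval i).comp hφ')
    exact hnofin S _ _ hS hS'
  obtain ⟨i₀, hi₀⟩ := exists_forall_mk_eq hind hφ hJ
    (by simpa [TwoSidedIdeal.jacobson, Ideal.jacobson_bot] using hsp.2) hinf
  have hop (i : Fin n) : #(D i)ᵐᵒᵖ = #(D i₀) := (hD i).trans (hi₀ i)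
  have hker (S : Type u) [AddCommGroup S] [Module Rᵐᵒᵖ S] [IsSimpleModule Rᵐᵒᵖ S] (a : Rᵐᵒᵖ)
      (ha : PiMatrix.opHom φ a = 0) (s : S) : a • s = 0 :=
    smul_eq_zero_of_mem_jacobson (op_mem_jacobson ((hJ _).1 (PiMatrix.opHom_eq_zero ha))) s
  have hle (S : Type u) [AddCommGroup S] [Module Rᵐᵒᵖ S] [IsSimpleModule Rᵐᵒᵖ S] :
      #S ≤ #(D i₀) :=
    mk_le_of_surjective_piMatrix hφ' (hker S) (hinf i₀) fun i ↦ (hop i).le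
  have hge (S : Type u) [AddCommGroup S] [Module Rᵐᵒᵖ S] [IsSimpleModule Rᵐᵒᵖ S] :
      #(D i₀) ≤ #(Module.End Rᵐᵒᵖ S) :=
    le_mk_end_of_surjective_piMatrix hφ' (hker S) fun i ↦ (hop i).ge
  refine ⟨#(D i₀), hinf i₀, fun M _ _ hM _ ↦ hM.mk_eq (hinf i₀) fun S _ _ _ ↦ ?_,
    fun S _ _ _ ↦ (mk_end_le_mk.trans (hle S)).antisymm (hge S)⟩
  exact (hle S).antisymm ((hge S).trans mk_end_le_mk)
end
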